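/- arXiv:0706.2772 — 3 statements merged into one kernel-verified Lean document; each statement's English description precedes it below -/
import Mathlib

section
/- There exists a constant C > 0, depending only on φ and K, such that for every ε ∈ (0,1] and every z_n ∈ ℝ, ∫₀¹ K((z_n − x_n)/(εφ(x_n))) (εφ(x_n))^{−1} dx_n ≤ C. -/
open MeasureTheory Set
open scoped ENNReal NNReal

noncomputable section
structure IsPeakFun (φ : ℝ → ℝ) : Prop where
  contDiffOn : ContDiffOn ℝ 1 φ (Icc 0 1)
  zero : φ 0 = 0
  deriv_zero : derivWithin φ (Icc 0 1) 0 = 0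
  deriv_pos : ∀ t ∈ Ioc (0:ℝ) 1, 0 < derivWithin φ (Icc 0 1) t
  deriv_lt_one : ∀ t ∈ Ioc (0:ℝ) 1, derivWithin φ (Icc 0 1) t < 1

/-- A nonnegative `K ∈ C_c^∞(ℝ)` with `supp K ⊆ [1/2,1]` and `∫ K = 1`. -/
structure IsKernelK (K : ℝ → ℝ) : Prop where
  smooth : ContDiff ℝ (⊤ : ℕ∞) K
  nonneg : ∀ t, 0 ≤ K t
  supp : Function.support K ⊆ Icc (1/2 : ℝ) 1
  integral_one : ∫ t, K t = 1

/-- The uniform bound `∫₀¹ K((z_n - x_n)/(εφ(x_n))) (εφ(x_n))⁻¹ dx_n ≤ C`. -/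
theorem K_layer_integral_bound (φ : ℝ → ℝ) (hφ : IsPeakFun φ)
    (K : ℝ → ℝ) (hK : IsKernelK K) :
    ∃ C : ℝ, 0 < C ∧ ∀ ε ∈ Ioc (0:ℝ) 1, ∀ zn : ℝ,
      (∫⁻ xn in Ioo (0:ℝ) 1,
          ENNReal.ofReal (K ((zn - xn) / (ε * φ xn)) * (ε * φ xn)⁻¹)) ≤
        ENNReal.ofReal C := by
  have hmono : StrictMonoOn φ (Icc 0 1) := by
    apply strictMonoOn_of_deriv_pos (convex_Icc 0 1) hφ.contDiffOn.continuousOn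
    intro x hx
    rw [interior_Icc] at hx
    rw [← derivWithin_of_mem_nhds (Icc_mem_nhds hx.1 hx.2)]
    exact hφ.deriv_pos x ⟨hx.1, hx.2.le⟩
  have hpos : ∀ x ∈ Ioo (0:ℝ) 1, 0 < φ x := by
    intro x hx
    have := hmono (a := 0) (b := x) ⟨le_rfl, zero_le_one⟩ ⟨hx.1.le, hx.2.le⟩ hx.1
    rwa [hφ.zero] at this
  obtain ⟨M, hM0, hM⟩ : ∃ M : ℝ, 0 < M ∧ ∀ t, K t ≤ M := by
    obtain ⟨B, hB⟩ := (isCompact_Icc (a := (1/2:ℝ)) (b := 1)).exists_bound_of_continuousOn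
      hK.smooth.continuous.continuousOn
    refine ⟨max B 1, by positivity, fun t => ?_⟩
    by_cases ht : K t = 0
    · rw [ht]; positivity
    · exact (le_abs_self _).trans ((hB t (hK.supp ht)).trans (le_max_left _ _))
  refine ⟨2 * M, by positivity, fun ε hε zn => ?_⟩
  have hε0 : 0 < ε := hε.1
  have key : ∀ x ∈ Ioo (0:ℝ) 1, K ((zn - x) / (ε * φ x)) ≠ 0 →
      ε * φ x / 2 ≤ zn - x ∧ zn - x ≤ ε * φ x := by
    intro x hx h
    have h1 := hK.supp h
    have hp : 0 < ε * φ x := mul_pos hε0 (hpos x hx)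
    have h2 := (le_div_iff₀ hp).1 h1.1
    have h3 := (div_le_iff₀ hp).1 h1.2
    constructor <;> linarith
  by_cases hS : ∃ y ∈ Ioo (0:ℝ) 1, K ((zn - y) / (ε * φ y)) ≠ 0
  · obtain ⟨y, hy, hKy⟩ := hS
    obtain ⟨hy1, hy2⟩ := key y hy hKy
    have hpy : 0 < ε * φ y := mul_pos hε0 (hpos y hy)
    set d := ε * φ y with hd
    calc (∫⁻ xn in Ioo (0:ℝ) 1,
          ENNReal.ofReal (K ((zn - xn) / (ε * φ xn)) * (ε * φ xn)⁻¹))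
        ≤ ∫⁻ xn in Ioo (0:ℝ) 1,
          (Icc (y - d / 2) (y + d / 2)).indicator
            (fun _ => ENNReal.ofReal (M * (d / 2)⁻¹)) xn := by
          apply setLIntegral_mono' measurableSet_Ioo
          intro x hx
          by_cases hKx : K ((zn - x) / (ε * φ x)) = 0
          · simp [hKx]
          obtain ⟨hx1, hx2⟩ := key x hx hKx
          have hpx : 0 < ε * φ x := mul_pos hε0 (hpos x hx)
          have hxy : x ∈ Icc (y - d / 2) (y + d / 2) ∧ d / 2 ≤ ε * φ x := by
            rcases le_total x y with h | h
            · have := mul_le_mul_of_nonneg_left (hmono.monotoneOn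
                ⟨hx.1.le, hx.2.le⟩ ⟨hy.1.le, hy.2.le⟩ h) hε0.le
              refine ⟨⟨?_, ?_⟩, ?_⟩ <;> linarith
            · have := mul_le_mul_of_nonneg_left (hmono.monotoneOn
                ⟨hy.1.le, hy.2.le⟩ ⟨hx.1.le, hx.2.le⟩ h) hε0.le
              refine ⟨⟨?_, ?_⟩, ?_⟩ <;> linarith
          rw [indicator_of_mem hxy.1]
          apply ENNReal.ofReal_le_ofReal
          have h2 : (ε * φ x)⁻¹ ≤ (d / 2)⁻¹ := inv_anti₀ (by positivity) hxy.2
          exact mul_le_mul (hM _) h2 (by positivity) hM0.le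
      _ ≤ ∫⁻ xn, (Icc (y - d / 2) (y + d / 2)).indicator
            (fun _ => ENNReal.ofReal (M * (d / 2)⁻¹)) xn := setLIntegral_le_lintegral _ _
      _ = ENNReal.ofReal (2 * M) := by
          rw [lintegral_indicator_const measurableSet_Icc, Real.volume_Icc,
            ← ENNReal.ofReal_mul (by positivity)]
          congr 1
          field_simp
          ring
  · push Not at hS
    rw [setLIntegral_congr_fun (g := fun _ => 0) measurableSet_Ioo
      (fun x hx => by simp [hS x hx])]
    simp
end
end

section
/- Let H be a complex Hilbert space, E a normed space over ℂ, J : H → E a compact continuous linear operator, and B : H → H a continuous linear operator. Suppose there is a constant C ≥ 0 such that ‖B w‖² ≤ C ‖w‖ ‖J(B w)‖ for all w ∈ H. Then B is a compact operator. -/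
/-- If `J : H → E` is a compact operator and `B : H → H` satisfies
`‖Bw‖² ≤ C ‖w‖ ‖J(Bw)‖` for all `w`, then `B` is compact. -/
theorem compact_of_norm_sq_le (H E : Type*)
    [NormedAddCommGroup H] [InnerProductSpace ℂ H] [CompleteSpace H]
    [NormedAddCommGroup E] [NormedSpace ℂ E]
    (J : H →L[ℂ] E) (hJ : IsCompactOperator J)
    (B : H →L[ℂ] H) (C : ℝ) (hC : 0 ≤ C)
    (hest : ∀ w : H, ‖B w‖ ^ 2 ≤ C * ‖w‖ * ‖J (B w)‖) :
    IsCompactOperator B := by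
  have hJB : IsCompactOperator (J ∘L B : H →L[ℂ] E) := hJ.comp_clm B
  obtain ⟨K, hK, hsub⟩ :=
    hJB.image_closedBall_subset_compact (f := ((J ∘L B : H →L[ℂ] E) : H →ₗ[ℂ] E)) 1
  have htb := hK.totallyBounded.subset hsub
  refine (isCompactOperator_iff_isCompact_closure_image_closedBall
    (B : H →ₗ[ℂ] H) zero_lt_one).2 ?_
  refine TotallyBounded.isCompact_of_isClosed (TotallyBounded.closure ?_) isClosed_closure
  rw [Metric.totallyBounded_iff]
  intro ε hε
  have hδ : 0 < ε ^ 2 / (2 * C + 1) := by positivity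
  obtain ⟨u, hu, huf, htc⟩ := Set.exists_subset_image_finite_and.1
    (Metric.finite_approx_of_totallyBounded htb _ hδ)
  refine ⟨B '' u, huf.image _, ?_⟩
  rintro _ ⟨x, hx, rfl⟩
  have h1 := htc ⟨x, hx, rfl⟩
  simp only [Set.mem_iUnion, Set.mem_image, exists_prop] at h1 ⊢
  obtain ⟨_, ⟨y, hy, rfl⟩, hd⟩ := h1
  refine ⟨_, ⟨y, hy, rfl⟩, ?_⟩
  rw [Metric.mem_ball, dist_eq_norm] at hd ⊢
  have hd' : ‖J (B (x - y))‖ < ε ^ 2 / (2 * C + 1) := by simpa using hd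
  have hx1 : ‖x‖ ≤ 1 := by simpa using hx
  have hy1 : ‖y‖ ≤ 1 := by simpa using hu hy
  have hxy : ‖x - y‖ ≤ 2 := (norm_sub_le x y).trans (by linarith)
  have h2 : ‖B (x - y)‖ ^ 2 < ε ^ 2 := by
    calc ‖B (x - y)‖ ^ 2 ≤ C * ‖x - y‖ * ‖J (B (x - y))‖ := hest _
      _ ≤ C * 2 * (ε ^ 2 / (2 * C + 1)) := by gcongr
      _ < (2 * C + 1) * (ε ^ 2 / (2 * C + 1)) := by
        apply mul_lt_mul_of_pos_right _ hδ
        linarith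
      _ = ε ^ 2 := by field_simp
  have h3 := lt_of_pow_lt_pow_left₀ 2 hε.le h2
  simpa using h3
end

section
/- Let H be a complex Hilbert space, E a normed space over ℂ, J : H → E a compact continuous linear operator, and B : H → H a continuous linear operator. Suppose there is a constant C ≥ 0 such that ‖B w‖² ≤ C ‖J w‖ ‖J(B w)‖ for all w ∈ H. Then B is a compact operator. -/
/-- If `J : H → E` is a compact operator and `B : H → H` satisfies
`‖Bw‖² ≤ C ‖Jw‖ ‖J(Bw)‖` for all `w`, then `B` is compact. -/
theorem compact_of_norm_sq_le' (H E : Type*)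
    [NormedAddCommGroup H] [InnerProductSpace ℂ H] [CompleteSpace H]
    [NormedAddCommGroup E] [NormedSpace ℂ E]
    (J : H →L[ℂ] E) (hJ : IsCompactOperator J)
    (B : H →L[ℂ] H) (C : ℝ) (hC : 0 ≤ C)
    (hest : ∀ w : H, ‖B w‖ ^ 2 ≤ C * ‖J w‖ * ‖J (B w)‖) :
    IsCompactOperator B := by
  have key : ∀ w, ‖B w‖ ≤ C * ‖J‖ * ‖J w‖ := by
    intro w
    rcases eq_or_lt_of_le (norm_nonneg (B w)) with h | h
    · rw [← h]; positivity
    · have h1 := J.le_opNorm (B w)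
      have h2 : C * ‖J w‖ * ‖J (B w)‖ ≤ C * ‖J w‖ * (‖J‖ * ‖B w‖) := by gcongr
      have h3 := hest w
      refine le_of_mul_le_mul_right ?_ h
      nlinarith
  obtain ⟨K, hK, hKJ⟩ := IsCompactOperator.image_ball_subset_compact
    (f := (J : H →ₗ[ℂ] E)) hJ 1
  have htb : TotallyBounded (J '' Metric.ball (0 : H) 1) := hK.totallyBounded.subset hKJ
  refine (isCompactOperator_iff_isCompact_closure_image_ball (B : H →ₗ[ℂ] H) one_pos).mpr ?_
  refine TotallyBounded.isCompact_of_isClosed (TotallyBounded.closure ?_) isClosed_closure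
  rw [Metric.totallyBounded_iff]
  intro ε hε
  have hM : 0 ≤ C * ‖J‖ := by positivity
  obtain ⟨t, hts, htf, hcov⟩ := Metric.finite_approx_of_totallyBounded htb
    (ε / (C * ‖J‖ + 1)) (by positivity)
  choose! g hg using fun y (hy : y ∈ t) => hts hy
  refine ⟨(fun y => B (g y)) '' t, htf.image _, ?_⟩
  rintro _ ⟨w, hw, rfl⟩
  have := hcov (Set.mem_image_of_mem J hw)
  simp only [Set.mem_iUnion, Metric.mem_ball] at this
  obtain ⟨y, hy, hd⟩ := this
  simp only [Set.mem_iUnion, Metric.mem_ball]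
  refine ⟨B (g y), Set.mem_image_of_mem _ hy, ?_⟩
  rw [← (hg y hy).2, dist_eq_norm, ← map_sub, lt_div_iff₀ (by positivity)] at hd
  have hk := key (w - g y)
  have : dist (B w) (B (g y)) < ε := by
    rw [dist_eq_norm, ← map_sub]
    rcases eq_or_lt_of_le (norm_nonneg (J (w - g y))) with h | h
    · rw [← h] at hk; linarith
    · nlinarith
  exact this
end
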